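/- arXiv:2005.03986 — 8 statements merged into one kernel-verified Lean document; each statement's English description precedes it below -/
import Mathlib

section
/- Let c ≥ 1 and a, b ≥ 1 be integers. Every c-closed graph G on at least (c−1)·binom(b−1, 2) + (a−1)·(b−1) + 1 vertices contains a clique of size a or an independent set of size b. -/
/-- A graph is `c`-closed if every pair of distinct nonadjacent vertices has
fewer than `c` common neighbors (i.e. at most `c - 1`). -/
def CClosed {V : Type*} (G : SimpleGraph V) (c : ℕ) : Prop :=
  ∀ u v : V, u ≠ v → ¬ G.Adj u v → (G.neighborSet u ∩ G.neighborSet v).ncard < c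

theorem stmt0 {V : Type*} [Fintype V] (G : SimpleGraph V) (c a b : ℕ)
    (hc : 1 ≤ c) (ha : 1 ≤ a) (hb : 1 ≤ b)
    (hclosed : CClosed G c)
    (hcard : (c - 1) * Nat.choose (b - 1) 2 + (a - 1) * (b - 1) + 1 ≤ Fintype.card V) :
    (∃ s : Finset V, G.IsNClique a s) ∨
      (∃ s : Finset V, s.card = b ∧ ∀ u ∈ s, ∀ w ∈ s, u ≠ w → ¬ G.Adj u w) := by
  classical
  by_contra hcon
  push Not at hcon
  obtain ⟨hcl, hind⟩ := hcon
  let P : Finset V → Prop := fun s => ∀ u ∈ s, ∀ w ∈ s, u ≠ w → ¬ G.Adj u w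
  have hsub : ∀ s t : Finset V, s ⊆ t → P t → P s :=
    fun s t h ht u hu w hw => ht u (h hu) w (h hw)
  have hPcard : ∀ s, P s → s.card ≤ b - 1 := by
    intro s hs
    by_contra hlt
    obtain ⟨t, hts, htc⟩ := Finset.exists_subset_card_eq (show b ≤ s.card by omega)
    obtain ⟨u, hu, w, hw, hne, hadj⟩ := hind t htc
    exact hs u (hts hu) w (hts hw) hne hadj
  have hCcard : ∀ s : Finset V, G.IsClique (s : Set V) → s.card ≤ a - 1 := by
    intro s hs
    by_contra hlt
    obtain ⟨t, hts, htc⟩ := Finset.exists_subset_card_eq (show a ≤ s.card by omega)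
    exact hcl t ⟨hs.subset (by exact_mod_cast hts), htc⟩
  obtain ⟨I, hI, hmax⟩ := Finset.exists_max_image (Finset.univ.filter P) Finset.card
    ⟨∅, by simp [P]⟩
  have hIP : P I := (Finset.mem_filter.1 hI).2
  have hmax' : ∀ s, P s → s.card ≤ I.card := fun s hs => hmax s (by simp [hs])
  let Q : V → Finset V := fun v =>
    insert v (Finset.univ.filter fun x => G.Adj x v ∧ ∀ w ∈ I, G.Adj x w → w = v)
  let R : Finset V → Finset V := fun p => Finset.univ.filter fun x => ∀ w ∈ p, G.Adj x w
  have hQ : ∀ v ∈ I, (Q v).card ≤ a - 1 := by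
    intro v hv
    apply hCcard
    simp only [Q, Finset.coe_insert, SimpleGraph.isClique_insert]
    refine ⟨?_, ?_⟩
    · intro x hx y hy hxy
      by_contra hadj
      simp only [Finset.coe_filter, Finset.mem_univ, true_and, Set.mem_setOf_eq] at hx hy
      have hxI : x ∉ I := fun h => hIP x h v hv hx.1.ne hx.1
      have hyI : y ∉ I := fun h => hIP y h v hv hy.1.ne hy.1
      have h1 : P (insert x (insert y (I.erase v))) := by
        intro u hu w hw hne h
        have h' := h.symm
        simp only [Finset.mem_insert, Finset.mem_erase] at hu hw
        rcases hu with rfl | rfl | ⟨hu1, hu2⟩ <;> rcases hw with rfl | rfl | ⟨hw1, hw2⟩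
        · exact hne rfl
        · exact hadj h
        · exact hw1 (hx.2 _ hw2 h)
        · exact hadj h'
        · exact hne rfl
        · exact hw1 (hy.2 _ hw2 h)
        · exact hu1 (hx.2 _ hu2 h')
        · exact hu1 (hy.2 _ hu2 h')
        · exact hIP _ hu2 _ hw2 hne h
      have h2 := hmax' _ h1
      rw [Finset.card_insert_of_notMem (by simp [hxy, hxI]),
        Finset.card_insert_of_notMem (by simp [hyI]), Finset.card_erase_of_mem hv] at h2
      omega
    · intro x hx _
      simp only [Finset.coe_filter, Finset.mem_univ, true_and, Set.mem_setOf_eq] at hx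
      exact hx.1.symm
  have hR : ∀ p ∈ I.powersetCard 2, (R p).card ≤ c - 1 := by
    intro p hp
    obtain ⟨hpI, hp2⟩ := Finset.mem_powersetCard.1 hp
    obtain ⟨u, v, huv, rfl⟩ := Finset.card_eq_two.1 hp2
    have h := hclosed u v huv (hIP u (hpI (by simp)) v (hpI (by simp)) huv)
    have he : G.neighborSet u ∩ G.neighborSet v = (R {u, v} : Set V) := by
      ext x
      simp [R, G.adj_comm]
    rw [he, Set.ncard_coe_finset] at h
    omega
  have hcover : (Finset.univ : Finset V) ⊆ (I.powersetCard 2).biUnion R ∪ I.biUnion Q := by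
    intro x _
    rw [Finset.mem_union, Finset.mem_biUnion, Finset.mem_biUnion]
    by_cases hxI : x ∈ I
    · exact Or.inr ⟨x, hxI, by simp [Q]⟩
    have hex : ∃ v ∈ I, G.Adj x v := by
      by_contra hno
      push Not at hno
      have h1 : P (insert x I) := by
        intro u hu w hw hne h
        simp only [Finset.mem_insert] at hu hw
        rcases hu with rfl | hu <;> rcases hw with rfl | hw
        · exact hne rfl
        · exact hno _ hw h
        · exact hno _ hu h.symm
        · exact hIP _ hu _ hw hne h
      have h2 := hmax' _ h1
      rw [Finset.card_insert_of_notMem hxI] at h2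
      omega
    obtain ⟨v, hv, hxv⟩ := hex
    by_cases hu : ∀ w ∈ I, G.Adj x w → w = v
    · exact Or.inr ⟨v, hv, by simp only [Q, Finset.mem_insert, Finset.mem_filter, Finset.mem_univ, true_and]; exact Or.inr ⟨hxv, hu⟩⟩
    · push Not at hu
      obtain ⟨w, hw, hxw, hwv⟩ := hu
      refine Or.inl ⟨{w, v}, ?_, by simp [R, hxv, hxw]⟩
      rw [Finset.mem_powersetCard]
      refine ⟨?_, Finset.card_pair hwv⟩
      intro z hz
      simp only [Finset.mem_insert, Finset.mem_singleton] at hz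
      rcases hz with rfl | rfl <;> assumption
  have hm := hPcard I hIP
  have h1 := Finset.card_biUnion_le_card_mul _ R _ hR
  have h2 := Finset.card_biUnion_le_card_mul _ Q _ hQ
  rw [Finset.card_powersetCard] at h1
  have h3 := (Finset.card_le_card hcover).trans (Finset.card_union_le _ _)
  rw [Finset.card_univ] at h3
  have h4 : I.card.choose 2 * (c - 1) ≤ (c - 1) * (b - 1).choose 2 := by
    rw [mul_comm]
    exact Nat.mul_le_mul_left _ (Nat.choose_le_choose 2 hm)
  have h5 : I.card * (a - 1) ≤ (a - 1) * (b - 1) := by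
    rw [mul_comm]
    exact Nat.mul_le_mul_left _ hm
  omega
end

section
/- Let G be a c-closed graph, let k ≥ 1, and let v be a vertex of G with degree at least (c−1)(k−1)+1. If G contains an independent set of size k, then G − v contains an independent set of size k. Consequently, G has an independent set of size k if and only if G − v has one. -/
/-- `G` contains an independent set of size `k`. -/
def HasIndepSet {V : Type*} (G : SimpleGraph V) (k : ℕ) : Prop :=
  ∃ s : Finset V, s.card = k ∧ ∀ u ∈ s, ∀ w ∈ s, u ≠ w → ¬ G.Adj u w

theorem exists_indep_avoiding {V : Type*} [Fintype V] (G : SimpleGraph V) (c k : ℕ)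
    (h : CClosed G c) (v : V)
    (hdeg : ((c : ℤ) - 1) * ((k : ℤ) - 1) + 1 ≤ ((G.neighborSet v).ncard : ℤ))
    (hG : HasIndepSet G k) :
    ∃ s : Finset V, v ∉ s ∧ s.card = k ∧ ∀ u ∈ s, ∀ w ∈ s, u ≠ w → ¬ G.Adj u w := by
  classical
  obtain ⟨s, hs, hi⟩ := hG
  by_cases hv : v ∈ s
  swap
  · exact ⟨s, hv, hs, hi⟩
  have hc : (s.erase v).card + 1 = k := by rw [Finset.card_erase_add_one hv, hs]
  have key : ∃ w, G.Adj v w ∧ ∀ u ∈ s.erase v, ¬ G.Adj u w := by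
    by_contra hcon
    push Not at hcon
    let f : V → Finset V := fun u => (G.neighborSet u ∩ G.neighborSet v).toFinset
    have hsub : (G.neighborSet v).toFinset ⊆ (s.erase v).biUnion f := by
      intro w hw
      have hw' : G.Adj v w := by simpa using hw
      obtain ⟨u, hu, huw⟩ := hcon w hw'
      refine Finset.mem_biUnion.2 ⟨u, hu, ?_⟩
      simp only [f, Set.mem_toFinset]
      exact ⟨huw, hw'⟩
    have h1 : (G.neighborSet v).ncard ≤ ∑ u ∈ s.erase v, (f u).card := by
      rw [Set.ncard_eq_toFinset_card']
      exact (Finset.card_le_card hsub).trans Finset.card_biUnion_le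
    have h2 : ∑ u ∈ s.erase v, ((f u).card : ℤ) ≤ ∑ u ∈ s.erase v, ((c : ℤ) - 1) := by
      refine Finset.sum_le_sum fun u hu => ?_
      have hu' := Finset.mem_erase.1 hu
      have := h u v hu'.1 (hi u hu'.2 v hv hu'.1)
      rw [Set.ncard_eq_toFinset_card'] at this
      change (f u).card < c at this
      omega
    rw [Finset.sum_const, nsmul_eq_mul] at h2
    have h3 : ((G.neighborSet v).ncard : ℤ) ≤ ∑ u ∈ s.erase v, ((f u).card : ℤ) := by
      exact_mod_cast h1
    have h4 : ((s.erase v).card : ℤ) = (k : ℤ) - 1 := by omega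
    rw [h4] at h2
    linarith [mul_comm ((c : ℤ) - 1) ((k : ℤ) - 1)]
  obtain ⟨w, hw, hn⟩ := key
  have hwt : w ∉ s.erase v := fun hwt =>
    hi v hv w (Finset.mem_erase.1 hwt).2 hw.ne hw
  refine ⟨insert w (s.erase v), ?_, by rw [Finset.card_insert_of_notMem hwt, hc], ?_⟩
  · simp [hw.ne]
  · intro a ha b hb hab
    rcases Finset.mem_insert.1 ha with rfl | ha2 <;>
      rcases Finset.mem_insert.1 hb with rfl | hb2
    · exact absurd rfl hab
    · exact fun e => hn b hb2 e.symm
    · exact hn a ha2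
    · exact hi a (Finset.mem_erase.1 ha2).2 b (Finset.mem_erase.1 hb2).2 hab

theorem stmt5 {V : Type*} [Fintype V] (G : SimpleGraph V) (c k : ℕ) (hk : 1 ≤ k)
    (h : CClosed G c) (v : V)
    (hdeg : ((c : ℤ) - 1) * ((k : ℤ) - 1) + 1 ≤ ((G.neighborSet v).ncard : ℤ)) :
    (HasIndepSet G k → HasIndepSet (G.induce ({v}ᶜ : Set V)) k) ∧
    (HasIndepSet G k ↔ HasIndepSet (G.induce ({v}ᶜ : Set V)) k) := by
  have fwd : HasIndepSet G k → HasIndepSet (G.induce ({v}ᶜ : Set V)) k := by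
    classical
    intro hG
    obtain ⟨s, hv, hs, hi⟩ := exists_indep_avoiding G c k h v hdeg hG
    refine ⟨s.subtype (fun x => x ∈ ({v}ᶜ : Set V)), ?_, ?_⟩
    · rw [Finset.card_subtype, Finset.filter_true_of_mem, hs]
      rintro x hx rfl
      exact hv hx
    · intro a ha b hb hab
      exact hi a (Finset.mem_subtype.1 ha) b (Finset.mem_subtype.1 hb)
        (fun e => hab (Subtype.ext e))
  refine ⟨fwd, fwd, ?_⟩
  rintro ⟨s, hs, hi⟩
  refine ⟨s.map (Function.Embedding.subtype _), by rw [Finset.card_map, hs], ?_⟩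
  intro a ha b hb hab
  obtain ⟨a, ha2, rfl⟩ := Finset.mem_map.1 ha
  obtain ⟨b, hb2, rfl⟩ := Finset.mem_map.1 hb
  exact hi a ha2 b hb2 (fun e => hab (by rw [e]))
end

section
/- Let G be a graph, B ⊆ V(G) a set of black vertices, and r, k ∈ ℕ. Suppose G has a set D ⊆ V(G) with |D| ≤ k such that |N[b] ∩ D| ≥ r for every b ∈ B. If v is a simplicial vertex of G with deg(v) ≥ r, then G has a set D' ⊆ V(G) with |D'| ≤ k and |N[b] ∩ D'| ≥ r for every b ∈ B such that v ∉ D'. -/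
theorem stmt6 {V : Type*} [Fintype V] (G : SimpleGraph V) (B : Set V) (r k : ℕ)
    (hex : ∃ D : Finset V, D.card ≤ k ∧
      ∀ b ∈ B, r ≤ ((insert b (G.neighborSet b)) ∩ (↑D : Set V)).ncard)
    (v : V) (hsimp : G.IsClique (G.neighborSet v))
    (hdeg : r ≤ (G.neighborSet v).ncard) :
    ∃ D' : Finset V, D'.card ≤ k ∧
      (∀ b ∈ B, r ≤ ((insert b (G.neighborSet b)) ∩ (↑D' : Set V)).ncard) ∧
      v ∉ D' := by
  classical
  obtain ⟨D, hk, hD⟩ := hex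
  by_cases hv : v ∈ D
  swap
  · exact ⟨D, hk, hD, hv⟩
  have key : ∀ b, v ∈ insert b (G.neighborSet b) →
      G.neighborSet v ⊆ insert b (G.neighborSet b) := by
    intro b hb x hx
    rcases hb with rfl | hb
    · exact Or.inr hx
    · by_cases h : x = b
      · exact Or.inl h
      · exact Or.inr (hsimp (SimpleGraph.Adj.symm hb) hx (Ne.symm h))
  by_cases hN : G.neighborSet v ⊆ (↑D : Set V)
  · refine ⟨D.erase v, (Finset.card_erase_le).trans hk, fun b hb => ?_, by simp⟩
    by_cases hvb : v ∈ insert b (G.neighborSet b)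
    · refine hdeg.trans (Set.ncard_le_ncard (fun x hx => ⟨key b hvb hx, ?_⟩) (Set.toFinite _))
      have h1 : x ≠ v := fun h => G.loopless.irrefl v (by simpa [h] using hx)
      have h2 : x ∈ D := hN hx
      simp [h1, h2]
    · refine (hD b hb).trans (Set.ncard_le_ncard (fun x hx => ⟨hx.1, ?_⟩) (Set.toFinite _))
      have h1 : x ≠ v := fun h => hvb (h ▸ hx.1)
      have h2 : x ∈ D := hx.2
      simp [h1, h2]
  · obtain ⟨u, hu, huD⟩ := Set.not_subset.1 hN
    have huD' : u ∉ D := huD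
    have huv : u ≠ v := fun h => huD' (h ▸ hv)
    refine ⟨insert u (D.erase v), ?_, fun b hb => ?_, by simp [huv.symm]⟩
    · have h1 := Finset.card_insert_le u (D.erase v)
      have h2 := Finset.card_erase_add_one hv
      omega
    by_cases hvb : v ∈ insert b (G.neighborSet b)
    · have h3 := Set.ncard_exchange (s := insert b (G.neighborSet b) ∩ (↑D : Set V))
        (a := u) (b := v) (fun h => huD h.2) ⟨hvb, hv⟩
      refine (hD b hb).trans (h3.symm.le.trans (Set.ncard_le_ncard ?_ (Set.toFinite _)))
      rintro x (rfl | ⟨⟨hx1, hx2⟩, hx3⟩)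
      · exact ⟨key b hvb hu, by simp⟩
      · have h1 : x ≠ v := hx3
        have h2 : x ∈ D := hx2
        exact ⟨hx1, by simp [h1, h2]⟩
    · refine (hD b hb).trans (Set.ncard_le_ncard (fun x hx => ⟨hx.1, ?_⟩) (Set.toFinite _))
      have h1 : x ≠ v := fun h => hvb (h ▸ hx.1)
      have h2 : x ∈ D := hx.2
      simp [h1, h2]
end

section
/- Let G be a c-closed bipartite graph and let b ≥ 1. If G contains at least 2b vertices of degree at least c·b, then G contains an induced matching of size at least b. -/
/-- `G` contains an induced matching of size `n`: a matching of size `n` such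
that endpoints of distinct edges are pairwise nonadjacent. -/
def HasInducedMatching {V : Type*} (G : SimpleGraph V) (n : ℕ) : Prop :=
  ∃ f g : Fin n → V, (∀ i, G.Adj (f i) (g i)) ∧
    ∀ i j, i ≠ j → (f i ≠ f j ∧ g i ≠ g j ∧ f i ≠ g j) ∧
      (¬ G.Adj (f i) (f j) ∧ ¬ G.Adj (g i) (g j) ∧ ¬ G.Adj (f i) (g j))

theorem stmt11_aux {V : Type*} [Fintype V] (G : SimpleGraph V) (c b : ℕ) (hc : 0 < c)
    (hb : 1 ≤ b) (h : CClosed G c)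
    (P : Set V) (hbip : ∀ ⦃u v : V⦄, G.Adj u v → (u ∈ P ↔ v ∉ P))
    (S : Set V) (hSP : S ⊆ P) (hS : b ≤ S.ncard)
    (hdeg : ∀ v ∈ S, c * b ≤ (G.neighborSet v).ncard) :
    HasInducedMatching G b := by
  classical
  obtain ⟨T, hTS, hT⟩ := Set.exists_subset_card_eq hS
  have hcard : Nat.card T = b := by rw [← hT]; rfl
  let e : Fin b ≃ T := (Finite.equivFinOfCardEq hcard).symm
  let f : Fin b → V := fun i => (e i : V)
  have hfinj : Function.Injective f := Subtype.val_injective.comp e.injective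
  have hfS : ∀ i, f i ∈ S := fun i => hTS (e i).2
  have hfP : ∀ i, f i ∈ P := fun i => hSP (hfS i)
  have hPP : ∀ u v, u ∈ P → v ∈ P → ¬ G.Adj u v := fun u v hu hv ha => (hbip ha).1 hu hv
  have hff : ∀ i j, ¬ G.Adj (f i) (f j) := fun i j => hPP _ _ (hfP i) (hfP j)
  have key : ∀ i, ∃ w, G.Adj (f i) w ∧ ∀ j, j ≠ i → ¬ G.Adj (f j) w := by
    intro i
    by_contra hcon
    push Not at hcon
    have hsub : (G.neighborSet (f i)).toFinset ⊆ (Finset.univ.erase i).biUnion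
        (fun j => (G.neighborSet (f i) ∩ G.neighborSet (f j)).toFinset) := by
      intro w hw
      simp only [Set.mem_toFinset, SimpleGraph.mem_neighborSet] at hw
      obtain ⟨j, hj, hja⟩ := hcon w hw
      simp only [Finset.mem_biUnion, Finset.mem_erase, Finset.mem_univ, and_true,
        Set.mem_toFinset, Set.mem_inter_iff, SimpleGraph.mem_neighborSet]
      exact ⟨j, hj, hw, hja⟩
    have h1 := Finset.card_le_card hsub
    have h2 : ((Finset.univ.erase i).biUnion
        (fun j => (G.neighborSet (f i) ∩ G.neighborSet (f j)).toFinset)).card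
        ≤ (Finset.univ.erase i).card * c := by
      apply Finset.card_biUnion_le_card_mul
      intro j hj
      rw [← Set.ncard_eq_toFinset_card']
      exact (h _ _ (fun hh => (Finset.ne_of_mem_erase hj) (hfinj hh).symm) (hff i j)).le
    rw [← Set.ncard_eq_toFinset_card'] at h1
    have h3 := hdeg _ (hfS i)
    rw [Finset.card_erase_of_mem (Finset.mem_univ i), Finset.card_univ, Fintype.card_fin] at h2
    obtain ⟨k, rfl⟩ : ∃ k, b = k + 1 := ⟨b - 1, by omega⟩
    simp only [Nat.add_sub_cancel] at h2
    nlinarith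
  choose g hg1 hg2 using key
  have hgP : ∀ i, g i ∉ P := fun i => (hbip (hg1 i)).1 (hfP i)
  refine ⟨f, g, hg1, fun i j hij => ⟨⟨fun hh => hij (hfinj hh), fun hh => ?_, fun hh => ?_⟩,
    hff i j, fun hh => ?_, hg2 j i hij⟩⟩
  · exact hg2 j i hij (hh ▸ hg1 i)
  · exact hgP j (hh ▸ hfP i)
  · exact hgP i ((hbip hh).2 (hgP j))

theorem stmt11 {V : Type*} [Fintype V] (G : SimpleGraph V) (c b : ℕ) (hb : 1 ≤ b)
    (h : CClosed G c)
    (P : Set V) (hbip : ∀ ⦃u v : V⦄, G.Adj u v → (u ∈ P ↔ v ∉ P))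
    (hmany : 2 * b ≤ {v : V | c * b ≤ (G.neighborSet v).ncard}.ncard) :
    HasInducedMatching G b := by
  classical
  rcases Nat.eq_zero_or_pos c with rfl | hc
  · have hadj : ∀ u v, u ≠ v → G.Adj u v := by
      intro u v huv
      by_contra hn
      exact absurd (h u v huv hn) (Nat.not_lt_zero _)
    obtain ⟨u, v, -, -, huv⟩ := (Set.one_lt_ncard_iff (Set.toFinite _)).1
      (lt_of_lt_of_le (by omega : 1 < 2 * b) hmany)
    rcases Nat.lt_or_ge 1 b with hb2 | hb2
    · exfalso
      obtain ⟨x, y, z, -, -, -, hxy, hxz, hyz⟩ := (Set.two_lt_ncard_iff (Set.toFinite _)).1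
        (lt_of_lt_of_le (by omega : 2 < 2 * b) hmany)
      have h1 := hbip (hadj _ _ hxy)
      have h2 := hbip (hadj _ _ hxz)
      have h3 := hbip (hadj _ _ hyz)
      tauto
    · refine ⟨fun _ => u, fun _ => v, fun _ => hadj u v huv, fun i j hij => ?_⟩
      exact absurd (Fin.ext (by omega)) hij
  · set S := {v : V | c * b ≤ (G.neighborSet v).ncard} with hSdef
    have hsum := Set.ncard_inter_add_ncard_diff_eq_ncard S P (Set.toFinite _)
    rcases Nat.lt_or_ge (S ∩ P).ncard b with hlt | hge
    · refine stmt11_aux G c b hc hb h Pᶜ ?_ (S \ P) (fun x hx => hx.2) (by omega)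
        (fun v hv => hv.1)
      intro u v huv
      have := hbip huv
      simp only [Set.mem_compl_iff]
      tauto
    · exact stmt11_aux G c b hc hb h P hbip (S ∩ P) (fun x hx => hx.2) hge (fun v hv => hv.1)
end

section
/- Let G be a c-closed bipartite graph and let b ≥ 1. If G has a matching of size at least 2cb² + 2b, then G contains an induced matching of size at least b. -/
/-- `G` contains a matching of size `n`: `n` edges `f i — g i` with pairwise
distinct endpoints. -/
def HasMatching {V : Type*} (G : SimpleGraph V) (n : ℕ) : Prop :=
  ∃ f g : Fin n → V, (∀ i, G.Adj (f i) (g i)) ∧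
    ∀ i j, i ≠ j → f i ≠ f j ∧ g i ≠ g j ∧ f i ≠ g j

theorem indep_greedy {α : Type*} [DecidableEq α] (r : α → α → Prop) [DecidableRel r] (hs : ∀ i j, r i j → r j i)
    (hr : ∀ i, r i i) (D : ℕ) (hD : 0 < D) :
    ∀ (k : ℕ) (T : Finset α), (∀ i ∈ T, (T.filter (fun j => r i j)).card ≤ D) →
      k * D ≤ T.card →
      ∃ S ⊆ T, S.card = k ∧ ∀ i ∈ S, ∀ j ∈ S, i ≠ j → ¬ r i j := by
  intro k
  induction k with
  | zero =>
    intro T _ _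
    exact ⟨∅, by simp, by simp, by simp⟩
  | succ k ih =>
    intro T hT hc
    have hpos : 0 < T.card := by
      have : 0 < (k + 1) * D := by positivity
      omega
    obtain ⟨x, hx⟩ := Finset.card_pos.mp hpos
    have h1 := hT x hx
    have h2 := Finset.card_filter_add_card_filter_not (s := T) (fun j => r x j)
    obtain ⟨S, hS, hSc, hSi⟩ := ih (T.filter (fun j => ¬ r x j))
      (fun i hi => le_trans (Finset.card_le_card
        (Finset.filter_subset_filter _ (Finset.filter_subset _ _)))
        (hT i (Finset.mem_filter.mp hi).1)) (by
          have : (k + 1) * D = k * D + D := by ring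
          omega)
    have hxr : ∀ j ∈ S, ¬ r x j := fun j hj => (Finset.mem_filter.mp (hS hj)).2
    refine ⟨insert x S, ?_, ?_, ?_⟩
    · intro y hy
      rcases Finset.mem_insert.mp hy with rfl | hy
      · exact hx
      · exact (Finset.mem_filter.mp (hS hy)).1
    · rw [Finset.card_insert_of_notMem (fun hxS => hxr x hxS (hr x)), hSc]
    · intro i hi j hj hij hrij
      rcases Finset.mem_insert.mp hi with hi1 | hi <;>
        rcases Finset.mem_insert.mp hj with hj1 | hj
      · exact hij (hi1.trans hj1.symm)
      · exact hxr j hj (hi1 ▸ hrij)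
      · exact hxr i hi (hs _ _ (hj1 ▸ hrij))
      · exact hSi i hi j hj hij hrij

open Classical in
theorem star_case {V : Type*} [Fintype V] (G : SimpleGraph V) (c b : ℕ) (hb : 1 ≤ b) (hc : 1 ≤ c)
    (h : CClosed G c)
    (P : Set V) (hbip : ∀ ⦃u v : V⦄, G.Adj u v → (u ∈ P ↔ v ∉ P))
    (S : Finset V) (hSP : ∀ x ∈ S, x ∈ P) (hS : S.card = b)
    (hdeg : ∀ x ∈ S, c * b ≤ (G.neighborFinset x).card) : HasInducedMatching G b := by
  have hna : ∀ x ∈ S, ∀ y ∈ S, ¬ G.Adj x y := fun x hx y hy hxy =>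
    (hbip hxy).mp (hSP x hx) (hSP y hy)
  have key : ∀ x ∈ S, ∃ p, G.Adj x p ∧ ∀ y ∈ S, y ≠ x → ¬ G.Adj y p := by
    intro x hx
    by_contra hcon
    push Not at hcon
    have hsub : G.neighborFinset x ⊆
        (S.erase x).biUnion (fun y => G.neighborFinset x ∩ G.neighborFinset y) := by
      intro p hp
      have hp' : G.Adj x p := by simpa using hp
      obtain ⟨y, hy, hyx, hyp⟩ := hcon p hp'
      simp only [Finset.mem_biUnion, Finset.mem_erase, Finset.mem_inter,
        SimpleGraph.mem_neighborFinset]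
      exact ⟨y, ⟨hyx, hy⟩, hp', hyp⟩
    have h1 := Finset.card_le_card hsub
    have h2 : ((S.erase x).biUnion
        (fun y => G.neighborFinset x ∩ G.neighborFinset y)).card ≤ (S.erase x).card * c := by
      apply Finset.card_biUnion_le_card_mul
      intro y hy
      obtain ⟨hyx, hyS⟩ := Finset.mem_erase.mp hy
      have := h x y (Ne.symm hyx) (hna x hx y hyS)
      rw [← Set.ncard_coe_finset]
      simpa using this.le
    rw [Finset.card_erase_of_mem hx, hS] at h2
    have h3 := hdeg x hx
    obtain ⟨b', rfl⟩ : ∃ b', b = b' + 1 := ⟨b - 1, by omega⟩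
    simp only [Nat.add_sub_cancel] at h2
    nlinarith
  choose! p hp1 hp2 using key
  let e := S.equivFinOfCardEq hS
  have hm : ∀ i, ((e.symm i : S) : V) ∈ S := fun i => (e.symm i).2
  have hinj : ∀ i j, i ≠ j → ((e.symm i : S) : V) ≠ (e.symm j : S) := by
    intro i j hij hh
    exact hij (e.symm.injective (Subtype.ext hh))
  have hpP : ∀ i, p (e.symm i : S) ∉ P := fun i =>
    (hbip (hp1 _ (hm i))).mp (hSP _ (hm i))
  refine ⟨fun i => (e.symm i : S), fun i => p (e.symm i : S), fun i => hp1 _ (hm i), ?_⟩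
  intro i j hij
  have hx : ¬ G.Adj ((e.symm i : S) : V) (p (e.symm j : S)) :=
    hp2 _ (hm j) _ (hm i) (hinj i j hij)
  refine ⟨⟨hinj i j hij, ?_, ?_⟩, hna _ (hm i) _ (hm j), ?_, hx⟩
  · intro hh
    apply hx
    dsimp only at hh
    rw [← hh]
    exact hp1 _ (hm i)
  · intro hh
    dsimp only at hh
    exact hpP j (hh ▸ hSP _ (hm i))
  · intro hh
    exact hpP i ((hbip hh).mpr (hpP j))

open Classical in
theorem main_oriented {V : Type*} [Fintype V] (G : SimpleGraph V) (c b : ℕ) (hb : 1 ≤ b)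
    (hc : 1 ≤ c) (h : CClosed G c)
    (P : Set V) (hbip : ∀ ⦃u v : V⦄, G.Adj u v → (u ∈ P ↔ v ∉ P))
    (f g : Fin (2 * c * b ^ 2 + 2 * b) → V) (hfg : ∀ i, G.Adj (f i) (g i))
    (hfP : ∀ i, f i ∈ P) (hf : Function.Injective f) (hg : Function.Injective g) :
    HasInducedMatching G b := by
  have hgP : ∀ i, g i ∉ P := fun i => (hbip (hfg i)).mp (hfP i)
  have side : ∀ (Q : Set V) (_ : ∀ ⦃u v : V⦄, G.Adj u v → (u ∈ Q ↔ v ∉ Q))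
      (k : Fin (2 * c * b ^ 2 + 2 * b) → V) (_ : ∀ i, k i ∈ Q) (_ : Function.Injective k),
      b ≤ (Finset.univ.filter (fun i => c * b ≤ (G.neighborFinset (k i)).card)).card →
      HasInducedMatching G b := by
    intro Q hQ k hkQ hk hcard
    obtain ⟨I, hI, hIc⟩ := Finset.exists_subset_card_eq hcard
    refine star_case G c b hb hc h Q hQ (I.image k) ?_ ?_ ?_
    · intro x hx
      obtain ⟨i, _, rfl⟩ := Finset.mem_image.mp hx
      exact hkQ i
    · rw [Finset.card_image_of_injective _ hk, hIc]
    · intro x hx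
      obtain ⟨i, hi, rfl⟩ := Finset.mem_image.mp hx
      exact (Finset.mem_filter.mp (hI hi)).2
  by_cases hA : b ≤ (Finset.univ.filter (fun i => c * b ≤ (G.neighborFinset (f i)).card)).card
  · exact side P hbip f hfP hf hA
  by_cases hB : b ≤ (Finset.univ.filter (fun i => c * b ≤ (G.neighborFinset (g i)).card)).card
  · refine side Pᶜ ?_ g hgP hg hB
    intro u v huv
    have := hbip huv
    simp only [Set.mem_compl_iff]
    tauto
  push Not at hA hB
  set X := Finset.univ.filter (fun i => c * b ≤ (G.neighborFinset (f i)).card)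
  set Y := Finset.univ.filter (fun i => c * b ≤ (G.neighborFinset (g i)).card)
  have hT : 2 * c * b ^ 2 ≤ ((X ∪ Y)ᶜ).card := by
    rw [Finset.card_compl, Fintype.card_fin]
    have := Finset.card_union_le X Y
    omega
  have hlow : ∀ i ∈ (X ∪ Y)ᶜ, (G.neighborFinset (f i)).card < c * b ∧
      (G.neighborFinset (g i)).card < c * b := by
    intro i hi
    rw [Finset.mem_compl, Finset.mem_union, not_or] at hi
    constructor
    · by_contra hh
      exact hi.1 (Finset.mem_filter.mpr ⟨Finset.mem_univ _, not_lt.mp hh⟩)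
    · by_contra hh
      exact hi.2 (Finset.mem_filter.mpr ⟨Finset.mem_univ _, not_lt.mp hh⟩)
  obtain ⟨S, hS, hSc, hSi⟩ := indep_greedy (fun i j => G.Adj (f i) (g j) ∨ G.Adj (f j) (g i))
    (fun i j hij => hij.symm) (fun i => Or.inl (hfg i)) (2 * (c * b)) (by positivity) b
    ((X ∪ Y)ᶜ) (by
      intro i hi
      obtain ⟨h1, h2⟩ := hlow i hi
      have e1 : (Finset.univ.filter (fun j => G.Adj (f i) (g j))).card
          ≤ (G.neighborFinset (f i)).card := by
        apply Finset.card_le_card_of_injOn g _ hg.injOn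
        intro j hj
        simpa using hj
      have e2 : (Finset.univ.filter (fun j => G.Adj (f j) (g i))).card
          ≤ (G.neighborFinset (g i)).card := by
        apply Finset.card_le_card_of_injOn f _ hf.injOn
        intro j hj
        simpa [G.adj_comm] using hj
      refine le_trans (Finset.card_le_card
        (t := Finset.univ.filter (fun j => G.Adj (f i) (g j)) ∪
           Finset.univ.filter (fun j => G.Adj (f j) (g i))) ?_)
        ((Finset.card_union_le _ _).trans ?_)
      · intro j hj
        have hj2 := ((@Finset.mem_filter _ _ _ _ _).mp hj).2
        simpa using hj2
      · omega) (by
      calc b * (2 * (c * b)) = 2 * c * b ^ 2 := by ring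
        _ ≤ _ := hT)
  let e := S.equivFinOfCardEq hSc
  have hinj : ∀ i j, i ≠ j → ((e.symm i : S) : Fin (2 * c * b ^ 2 + 2 * b)) ≠ (e.symm j : S) := by
    intro i j hij hh
    exact hij (e.symm.injective (Subtype.ext hh))
  refine ⟨fun i => f (e.symm i : S), fun i => g (e.symm i : S), fun i => hfg _, ?_⟩
  intro i j hij
  have hij' := hinj i j hij
  refine ⟨⟨hf.ne hij', hg.ne hij', ?_⟩, ?_, ?_, ?_⟩
  · intro hh
    dsimp only at hh
    exact hgP _ (hh ▸ hfP (e.symm i : S))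
  · intro hh
    exact (hbip hh).mp (hfP _) (hfP _)
  · intro hh
    exact hgP _ ((hbip hh).mpr (hgP _))
  · intro hh
    exact hSi _ (e.symm i).2 _ (e.symm j).2 hij' (Or.inl hh)

theorem stmt12 {V : Type*} [Fintype V] (G : SimpleGraph V) (c b : ℕ) (hb : 1 ≤ b)
    (h : CClosed G c)
    (P : Set V) (hbip : ∀ ⦃u v : V⦄, G.Adj u v → (u ∈ P ↔ v ∉ P))
    (hM : HasMatching G (2 * c * b ^ 2 + 2 * b)) :
    HasInducedMatching G b := by
  classical
  obtain ⟨f, g, hfg, hd⟩ := hM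
  have hfP : ∀ i, (if f i ∈ P then f i else g i) ∈ P := by
    intro i
    have := hbip (hfg i)
    split_ifs <;> tauto
  have hf : Function.Injective (fun i => if f i ∈ P then f i else g i) := by
    intro i j hij
    by_contra hne
    have h1 := hd i j hne
    have h2 := hd j i (Ne.symm hne)
    dsimp only at hij
    split_ifs at hij
    · exact h1.1 hij
    · exact h1.2.2 hij
    · exact h2.2.2 hij.symm
    · exact h1.2.1 hij
  have hg : Function.Injective (fun i => if f i ∈ P then g i else f i) := by
    intro i j hij
    by_contra hne
    have h1 := hd i j hne
    have h2 := hd j i (Ne.symm hne)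
    dsimp only at hij
    split_ifs at hij
    · exact h1.2.1 hij
    · exact h2.2.2 hij.symm
    · exact h1.2.2 hij
    · exact h1.1 hij
  have hc : 1 ≤ c := by
    by_contra hc0
    let i : Fin (2 * c * b ^ 2 + 2 * b) := ⟨0, by omega⟩
    let j : Fin (2 * c * b ^ 2 + 2 * b) := ⟨1, by omega⟩
    have hij : i ≠ j := by simp [i, j]
    have := h _ _ (hf.ne hij) (fun hh => (hbip hh).mp (hfP i) (hfP j))
    omega
  refine main_oriented G c b hb hc h P hbip _ _ ?_ hfP hf hg
  intro i
  split_ifs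
  · exact hfg i
  · exact (hfg i).symm
end

section
/- Define R_c(a, b) := (c−1)·binom(b−1, 2) + (a−1)(b−1) + 1 and Q_c(b) := 2cb² + 2b. Let G be a c-closed graph containing an independent set I of size at least Q_c(R_c(a, b)) together with a matching M of G that saturates I. Then G contains a clique of size a or an induced matching of size b. -/
/-- The Ramsey-type bound `R_c(a, b) = (c-1)·C(b-1, 2) + (a-1)(b-1) + 1`. -/
def Rc (c a b : ℕ) : ℕ := (c - 1) * Nat.choose (b - 1) 2 + (a - 1) * (b - 1) + 1

/-- The bound `Q_c(b) = 2cb² + 2b`. -/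
def Qc (c b : ℕ) : ℕ := 2 * c * b ^ 2 + 2 * b

open Finset in
theorem indep_digraph {V : Type*} (r : V → V → Prop) (C : ℕ) (I : Finset V)
    (hrefl : ∀ x ∈ I, r x x)
    (hC : ∀ x ∈ I, ∀ x' ∈ I, x ≠ x' → ∀ K : Finset V, K ⊆ I → (∀ y ∈ K, r x y ∧ r x' y) → K.card ≤ C)
    (k : ℕ) : ∀ J : Finset V, J ⊆ I → 2 * (C + 1) * k ^ 2 ≤ J.card →
      ∃ S : Finset V, S ⊆ J ∧ S.card = k ∧ ∀ x ∈ S, ∀ y ∈ S, x ≠ y → ¬ r x y := by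
  classical
  induction k with
  | zero => intro J _ _; exact ⟨∅, by simp⟩
  | succ k ih =>
    intro J0 hJ0 hcard0
    obtain ⟨J, hJJ0, hJc⟩ := Finset.exists_subset_card_eq hcard0
    have hJI : J ⊆ I := hJJ0.trans hJ0
    rcases Nat.eq_zero_or_pos k with hk | hk
    · subst hk
      have : 0 < J.card := by rw [hJc]; positivity
      obtain ⟨v, hv⟩ := Finset.card_pos.mp this
      refine ⟨{v}, by simpa using hJJ0 hv, by simp, ?_⟩
      intro x hx y hy hxy
      simp at hx hy
      exact absurd (hx.trans hy.symm) hxy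
    · obtain ⟨q, hq⟩ : ∃ q, q = (C + 1) * (2 * k + 1) := ⟨_, rfl⟩
      have key : ∃ v ∈ J, (J.filter (fun x => r x v)).card + (J.filter (fun y => r v y)).card ≤ 2 * q := by
        by_contra hcon
        push Not at hcon
        set D := ∑ v ∈ J, (J.filter (fun x => r x v)).card with hD
        have hD2 : ∑ v ∈ J, (J.filter (fun y => r v y)).card = D :=
          Finset.sum_card_bipartiteAbove_eq_sum_card_bipartiteBelow r
        have h1 : J.card * (2 * q) ≤ 2 * D := by
          calc J.card * (2 * q) = ∑ v ∈ J, 2 * q := by simp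
            _ ≤ ∑ v ∈ J, ((J.filter (fun x => r x v)).card + (J.filter (fun y => r v y)).card) :=
              Finset.sum_le_sum (fun v hv => (hcon v hv).le)
            _ = 2 * D := by rw [Finset.sum_add_distrib, hD2]; ring
        have h2 : ∑ y ∈ J, (J.filter (fun x => r x y)).offDiag.card ≤ J.offDiag.card * C := by
          have e1 : ∀ y ∈ J, (J.filter (fun x => r x y)).offDiag.card
              = (J.offDiag.filter (fun p => r p.1 y ∧ r p.2 y)).card := by
            intro y _
            congr 1
            ext p
            simp only [Finset.mem_offDiag, Finset.mem_filter]
            tauto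
          rw [Finset.sum_congr rfl e1]
          have e2 := Finset.sum_card_bipartiteAbove_eq_sum_card_bipartiteBelow
            (s := J.offDiag) (t := J) (fun (p : V × V) y => r p.1 y ∧ r p.2 y)
          unfold Finset.bipartiteAbove Finset.bipartiteBelow at e2
          rw [← e2]
          rw [← smul_eq_mul]
          apply Finset.sum_le_card_nsmul
          intro p hp
          rw [Finset.mem_offDiag] at hp
          exact hC p.1 (hJI hp.1) p.2 (hJI hp.2.1) hp.2.2 _
            ((Finset.filter_subset _ _).trans hJI) (fun y hy => (Finset.mem_filter.mp hy).2)
        have h3 : (∑ y ∈ J, (((J.filter (fun x => r x y)).card : ℤ) ^ 2 - (J.filter (fun x => r x y)).card))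
            ≤ ((J.card : ℤ) ^ 2 - J.card) * C := by
          have oc : ∀ s : Finset V, (s.offDiag.card : ℤ) = (s.card : ℤ) ^ 2 - s.card := by
            intro s
            rw [Finset.offDiag_card, Nat.cast_sub (Nat.le_mul_self _)]
            push_cast; ring
          have := h2
          zify at this
          simpa only [oc] using this
        have h4 : ∑ y ∈ J, ((2 * (q:ℤ) - 1) * ((J.filter (fun x => r x y)).card : ℤ) - q ^ 2) ≤
            (∑ y ∈ J, (((J.filter (fun x => r x y)).card : ℤ) ^ 2 - (J.filter (fun x => r x y)).card)) := by
          apply Finset.sum_le_sum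
          intro y _
          nlinarith [sq_nonneg (((J.filter (fun x => r x y)).card : ℤ) - q)]
        rw [Finset.sum_sub_distrib, ← Finset.mul_sum] at h4
        have hDz : (D : ℤ) = ∑ y ∈ J, ((J.filter (fun x => r x y)).card : ℤ) := by
          rw [hD]; push_cast; rfl
        rw [← hDz] at h4
        simp only [Finset.sum_const, nsmul_eq_mul] at h4
        have h5 := h4.trans h3
        have h1' : (J.card : ℤ) * q ≤ D := by
          have : J.card * q ≤ D := by nlinarith
          exact_mod_cast this
        have hnpos : (0 : ℤ) < J.card := by
          have : 0 < J.card := by rw [hJc]; positivity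
          exact_mod_cast this
        have hq1 : (1 : ℤ) ≤ q := by
          have : 1 ≤ q := by rw [hq]; nlinarith
          exact_mod_cast this
        have h6 : (J.card : ℤ) * (q * (q - 1)) ≤ J.card * ((J.card - 1) * C) := by
          nlinarith [mul_le_mul_of_nonneg_left h1' (by linarith : (0:ℤ) ≤ 2 * q - 1)]
        have h7 := le_of_mul_le_mul_left h6 hnpos
        have hqz : (q : ℤ) = (C + 1) * (2 * k + 1) := by rw [hq]; push_cast; ring
        have hJz : (J.card : ℤ) = 2 * (C + 1) * (k + 1) ^ 2 := by rw [hJc]; push_cast; ring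
        rw [hqz, hJz] at h7
        have hk' : (1 : ℤ) ≤ k := by exact_mod_cast hk
        have hC0 : (0 : ℤ) ≤ C := by positivity
        obtain ⟨j, hj⟩ : ∃ j : ℤ, (k : ℤ) = j + 1 := ⟨k - 1, by ring⟩
        have hj0 : 0 ≤ j := by linarith
        rw [hj] at h7
        have : 0 < ((C:ℤ) + 1) * (2 * (j + 1) + 1) * ((C + 1) * (2 * (j + 1) + 1) - 1) -
          (2 * (C + 1) * (j + 1 + 1) ^ 2 - 1) * C := by
          ring_nf
          positivity
        linarith
      obtain ⟨v, hv, hvd⟩ := key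
      set J' := J \ (J.filter (fun x => r x v) ∪ J.filter (fun y => r v y)) with hJ'
      have hJ'c : 2 * (C + 1) * k ^ 2 ≤ J'.card := by
        have a1 := Finset.le_card_sdiff (J.filter (fun x => r x v) ∪ J.filter (fun y => r v y)) J
        have a2 := Finset.card_union_le (J.filter (fun x => r x v)) (J.filter (fun y => r v y))
        have a3 : J.card = 2 * (C + 1) * k ^ 2 + 2 * q := by rw [hJc, hq]; ring
        rw [← hJ'] at a1
        omega
      have hJ'J : J' ⊆ J := Finset.sdiff_subset
      obtain ⟨S, hSJ, hSc, hS⟩ := ih J' (hJ'J.trans hJI) hJ'c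
      have hSv : ∀ x ∈ S, ¬ r x v ∧ ¬ r v x := by
        intro x hx
        have := hSJ hx
        rw [hJ'] at this
        simp only [Finset.mem_sdiff, Finset.mem_union, Finset.mem_filter] at this
        tauto
      have hvS : v ∉ S := fun hvS => (hSv v hvS).1 (hrefl v (hJI hv))
      refine ⟨insert v S, ?_, by rw [Finset.card_insert_of_notMem hvS, hSc], ?_⟩
      · exact Finset.insert_subset (hJJ0 hv) ((hSJ.trans hJ'J).trans hJJ0)
      · intro x hx y hy hxy
        rcases Finset.mem_insert.mp hx with rfl | hx0
        · rcases Finset.mem_insert.mp hy with rfl | hy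
          · exact absurd rfl hxy
          · exact (hSv y hy).2
        · rcases Finset.mem_insert.mp hy with rfl | hy
          · exact (hSv x hx0).1
          · exact hS x hx0 y hy hxy

theorem closed_common {V : Type*} [Fintype V] {G : SimpleGraph V} {c : ℕ} (h : CClosed G c)
    {u v : V} (huv : u ≠ v) (hn : ¬ G.Adj u v) (K : Finset V)
    (hK : ∀ w ∈ K, G.Adj u w ∧ G.Adj v w) : K.card ≤ c - 1 := by
  have h1 := h u v huv hn
  have h2 : (K : Set V).ncard ≤ (G.neighborSet u ∩ G.neighborSet v).ncard :=
    Set.ncard_le_ncard (fun w hw => hK w hw) (Set.toFinite _)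
  rw [Set.ncard_coe_finset] at h2
  omega

theorem closed_ramsey {V : Type*} [Fintype V] (G : SimpleGraph V) (c a b : ℕ)
    (h : CClosed G c) (T : Finset V) (hT : Rc c a b ≤ T.card) :
    (∃ s : Finset V, G.IsNClique a s) ∨
      ∃ S ⊆ T, S.card = b ∧ ∀ x ∈ S, ∀ y ∈ S, x ≠ y → ¬ G.Adj x y := by
  classical
  by_contra hcon
  push Not at hcon
  obtain ⟨hcl, hin⟩ := hcon
  let P : Finset V → Prop := fun S => ∀ x ∈ S, ∀ y ∈ S, x ≠ y → ¬ G.Adj x y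
  obtain ⟨S, hS, hmax⟩ := Finset.exists_max_image (T.powerset.filter P) Finset.card
    ⟨∅, by simp [P]⟩
  simp only [Finset.mem_filter, Finset.mem_powerset] at hS hmax
  obtain ⟨hST, hSP⟩ := hS
  have hSb : S.card < b := by
    by_contra hb
    push Not at hb
    obtain ⟨S', hS', hc'⟩ := Finset.exists_subset_card_eq hb
    obtain ⟨x, hx, y, hy, hxy, hadj⟩ := hin S' (hS'.trans hST) hc'
    exact hSP x (hS' hx) y (hS' hy) hxy hadj
  let cl : V → Finset V := fun v =>
    T.filter (fun w => w = v ∨ (G.Adj w v ∧ ∀ u ∈ S, u ≠ v → ¬ G.Adj w u))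
  let cm : Finset V → Finset V := fun p => T.filter (fun w => ∀ u ∈ p, G.Adj u w)
  have hcov : T ⊆ (S.powersetCard 2).biUnion cm ∪ S.biUnion cl := by
    intro w hw
    rw [Finset.mem_union, Finset.mem_biUnion, Finset.mem_biUnion]
    by_cases hwS : w ∈ S
    · exact Or.inr ⟨w, hwS, by simp [cl, hw]⟩
    by_cases hex : ∃ v ∈ S, G.Adj w v
    · obtain ⟨v, hv, hwv⟩ := hex
      by_cases hex2 : ∃ u ∈ S, u ≠ v ∧ G.Adj w u
      · obtain ⟨u, hu, huv, hwu⟩ := hex2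
        refine Or.inl ⟨{u, v}, ?_, ?_⟩
        · rw [Finset.mem_powersetCard]
          exact ⟨by simp [Finset.insert_subset_iff, hu, hv], Finset.card_pair huv⟩
        · simp [cm, hw, hwu.symm, hwv.symm]
      · push Not at hex2
        refine Or.inr ⟨v, hv, ?_⟩
        simp only [cl, Finset.mem_filter]
        exact ⟨hw, Or.inr ⟨hwv, hex2⟩⟩
    · push Not at hex
      exfalso
      have := hmax (insert w S) ⟨Finset.insert_subset hw hST, by
        intro x hx y hy hxy
        rcases Finset.mem_insert.mp hx with rfl | hx0
        · rcases Finset.mem_insert.mp hy with rfl | hy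
          · exact absurd rfl hxy
          · exact hex y hy
        · rcases Finset.mem_insert.mp hy with rfl | hy
          · exact fun hh => hex x hx0 hh.symm
          · exact hSP x hx0 y hy hxy⟩
      rw [Finset.card_insert_of_notMem hwS] at this
      omega
  have hcm : ∀ p ∈ S.powersetCard 2, (cm p).card ≤ c - 1 := by
    intro p hp
    rw [Finset.mem_powersetCard] at hp
    obtain ⟨u, v, huv, rfl⟩ := Finset.card_eq_two.mp hp.2
    have hu : u ∈ S := hp.1 (by simp)
    have hv : v ∈ S := hp.1 (by simp)
    refine closed_common h huv (hSP u hu v hv huv) _ ?_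
    intro w hw
    have := (Finset.mem_filter.mp hw).2
    exact ⟨this u (by simp), this v (by simp)⟩
  have hclq : ∀ v ∈ S, (cl v).card ≤ a - 1 := by
    intro v hv
    have hclique : G.IsClique (cl v : Set V) := by
      intro x hx y hy hxy
      have hx' := Finset.mem_filter.mp (Finset.mem_coe.mp hx)
      have hy' := Finset.mem_filter.mp (Finset.mem_coe.mp hy)
      obtain ⟨hxT, hx'⟩ := hx'
      obtain ⟨hyT, hy'⟩ := hy'
      rcases hx' with rfl | ⟨hxv, hxS⟩
      · rcases hy' with rfl | ⟨hyv, hyS⟩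
        · exact absurd rfl hxy
        · exact hyv.symm
      · rcases hy' with rfl | ⟨hyv, hyS⟩
        · exact hxv
        · by_contra hnadj
          have hxnS : x ∉ S := fun hh => hSP x hh v hv hxv.ne hxv
          have hynS : y ∉ S := fun hh => hSP y hh v hv hyv.ne hyv
          have := hmax (insert x (insert y (S.erase v))) ⟨by
            refine Finset.insert_subset hxT (Finset.insert_subset hyT ?_)
            exact (Finset.erase_subset _ _).trans hST, by
            intro p hp q hq hpq
            simp only [Finset.mem_insert, Finset.mem_erase] at hp hq
            rcases hp with rfl | rfl | ⟨hpv, hp⟩ <;> rcases hq with rfl | rfl | ⟨hqv, hq⟩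
            · exact absurd rfl hpq
            · exact hnadj
            · exact hxS q hq hqv
            · exact fun hh => hnadj hh.symm
            · exact absurd rfl hpq
            · exact hyS q hq hqv
            · exact fun hh => hxS p hp hpv hh.symm
            · exact fun hh => hyS p hp hpv hh.symm
            · exact hSP p hp q hq hpq⟩
          rw [Finset.card_insert_of_notMem (by simp [hxy, hxnS]),
            Finset.card_insert_of_notMem (by simp [hynS]), Finset.card_erase_of_mem hv] at this
          have : 0 < S.card := Finset.card_pos.mpr ⟨v, hv⟩
          omega
    by_contra hlt
    obtain ⟨s, hs, hsc⟩ := Finset.exists_subset_card_eq (show a ≤ (cl v).card by omega)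
    exact hcl s ⟨hclique.subset (by exact_mod_cast hs), hsc⟩
  have c1 : ((S.powersetCard 2).biUnion cm).card ≤ (S.card.choose 2) * (c - 1) := by
    have := Finset.card_biUnion_le_card_mul _ cm _ hcm
    rwa [Finset.card_powersetCard] at this
  have c2 := Finset.card_biUnion_le_card_mul _ cl _ hclq
  have c3 := (Finset.card_le_card hcov).trans (Finset.card_union_le _ _)
  have c4 : S.card ≤ b - 1 := by omega
  have c5 : S.card.choose 2 * (c - 1) ≤ (c - 1) * (b - 1).choose 2 := by
    rw [mul_comm]
    exact Nat.mul_le_mul_left _ (Nat.choose_le_choose 2 c4)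
  have c6 : S.card * (a - 1) ≤ (a - 1) * (b - 1) := by
    rw [mul_comm]
    exact Nat.mul_le_mul_left _ c4
  unfold Rc at hT
  omega

theorem stmt13 {V : Type*} [Fintype V] (G : SimpleGraph V) (c a b : ℕ)
    (h : CClosed G c)
    (I : Finset V) (hI : Qc c (Rc c a b) ≤ I.card)
    (hindep : ∀ u ∈ I, ∀ w ∈ I, u ≠ w → ¬ G.Adj u w)
    -- a matching of `G` saturating `I`, given by the partner `m x` of each `x ∈ I`
    (m : V → V) (hm : ∀ x ∈ I, G.Adj x (m x))
    (hminj : ∀ x ∈ I, ∀ y ∈ I, x ≠ y → m x ≠ m y) :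
    (∃ s : Finset V, G.IsNClique a s) ∨ HasInducedMatching G b := by
  classical
  have hR : 1 ≤ Rc c a b := by unfold Rc; omega
  have hinj : Set.InjOn m (I : Set V) := by
    intro x hx y hy hxy
    by_contra hne
    exact hminj x hx y hy hne hxy
  have hmI : ∀ x ∈ I, m x ∉ I := fun x hx hmx => hindep x hx _ hmx (hm x hx).ne (hm x hx)
  have hc : 1 ≤ c := by
    have h2 : 1 < I.card := by unfold Qc at hI; omega
    obtain ⟨x, hx, y, hy, hxy⟩ := Finset.one_lt_card.mp h2
    have := h x y hxy (hindep x hx y hy hxy)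
    omega
  obtain ⟨S, hSI, hSc, hS⟩ := indep_digraph (fun x y => G.Adj x (m y)) (c - 1) I hm
    (by
      intro x hx x' hx' hxx K hK hKr
      have hK2 := closed_common h hxx (hindep x hx x' hx' hxx) (K.image m) (by
        intro w hw
        obtain ⟨y, hy, rfl⟩ := Finset.mem_image.mp hw
        exact hKr y hy)
      rwa [Finset.card_image_of_injOn (hinj.mono (by exact_mod_cast hK))] at hK2)
    (Rc c a b) I (Finset.Subset.refl _) (by
      rw [Nat.sub_add_cancel hc]; unfold Qc at hI; omega)
  have hTc : Rc c a b ≤ (S.image m).card := by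
    rw [Finset.card_image_of_injOn (hinj.mono (by exact_mod_cast hSI)), hSc]
  rcases closed_ramsey G c a b h (S.image m) hTc with hcl | ⟨U, hU, hUc, hUi⟩
  · exact Or.inl hcl
  right
  obtain ⟨e⟩ : Nonempty (Fin b ≃ U) := ⟨(Finset.equivFinOfCardEq hUc).symm⟩
  have hpre : ∀ i : Fin b, ∃ x ∈ S, m x = (e i : V) := fun i =>
    Finset.mem_image.mp (hU (e i).2)
  choose f hfS hfm using hpre
  refine ⟨f, fun i => m (f i), fun i => hm _ (hSI (hfS i)), ?_⟩
  intro i j hij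
  have hg : m (f i) ≠ m (f j) := by
    rw [hfm, hfm]
    exact fun hh => hij (e.injective (Subtype.ext hh))
  have hf : f i ≠ f j := fun hh => hg (by rw [hh])
  refine ⟨⟨hf, hg, ?_⟩, hindep _ (hSI (hfS i)) _ (hSI (hfS j)) hf, ?_, hS _ (hfS i) _ (hfS j) hf⟩
  · intro hh
    have hh : f i = m (f j) := hh
    exact hmI _ (hSI (hfS j)) (hh ▸ hSI (hfS i))
  · have := hUi (e i) (e i).2 (e j) (e j).2 (by rw [← hfm, ← hfm]; exact hg)
    rwa [← hfm, ← hfm] at this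
end

section
/- Define R_c(a, b) := (c−1)·binom(b−1, 2) + (a−1)(b−1) + 1 and Q_c(b) := 2cb² + 2b. Let G be a c-closed graph with a matching of size at least Q_c(R_c(a, R_c(a, b))). Then G contains a clique of size a or an induced matching of size b. -/
open Classical in
theorem common_le {V : Type*} [Fintype V] {G : SimpleGraph V} {c : ℕ} (h : CClosed G c)
    {u v : V} (huv : u ≠ v) (hn : ¬ G.Adj u v) :
    (Finset.univ.filter (fun x => G.Adj u x ∧ G.Adj v x)).card ≤ c - 1 := by
  have h1 := h u v huv hn
  have h2 : G.neighborSet u ∩ G.neighborSet v =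
      ((Finset.univ.filter (fun x => G.Adj u x ∧ G.Adj v x) : Finset V) : Set V) := by
    ext x; simp
  rw [h2, Set.ncard_coe_finset] at h1
  omega

theorem clique_lt {V : Type*} {G : SimpleGraph V} {a : ℕ}
    (hno : ¬ ∃ s : Finset V, G.IsNClique a s) (s : Finset V)
    (hs : ∀ x ∈ s, ∀ y ∈ s, x ≠ y → G.Adj x y) : s.card ≤ a - 1 := by
  by_contra hlt
  have : a ≤ s.card := by omega
  obtain ⟨t, hts, htc⟩ := Finset.exists_subset_card_eq this
  exact hno ⟨t, ⟨fun x hx y hy hxy => hs x (hts hx) y (hts hy) hxy, htc⟩⟩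

open Classical in
theorem ramsey_closed {V : Type*} [Fintype V] {G : SimpleGraph V} {c a b : ℕ}
    (h : CClosed G c) (hno : ¬ ∃ s : Finset V, G.IsNClique a s) (S : Finset V)
    (hS : Rc c a b ≤ S.card) :
    ∃ T ⊆ S, T.card = b ∧ ∀ x ∈ T, ∀ y ∈ T, ¬ G.Adj x y := by
  suffices H : ∃ T ⊆ S, b ≤ T.card ∧ ∀ x ∈ T, ∀ y ∈ T, ¬ G.Adj x y by
    obtain ⟨T, hTS, hb, hT⟩ := H
    obtain ⟨t, htT, htc⟩ := Finset.exists_subset_card_eq hb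
    exact ⟨t, htT.trans hTS, htc, fun x hx y hy => hT x (htT hx) y (htT hy)⟩
  obtain ⟨T, hTm, hmax⟩ := Finset.exists_max_image
    (S.powerset.filter (fun T => ∀ x ∈ T, ∀ y ∈ T, ¬ G.Adj x y)) Finset.card
    ⟨∅, by simp⟩
  simp only [Finset.mem_filter, Finset.mem_powerset] at hTm hmax
  obtain ⟨hTS, hT⟩ := hTm
  refine ⟨T, hTS, ?_, hT⟩
  by_contra hlt
  push Not at hlt
  let A : Finset V → Finset V := fun e => S.filter (fun v => ∀ w ∈ e, G.Adj w v)
  let B : V → Finset V := fun w => S.filter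
    (fun v => v = w ∨ (G.Adj w v ∧ ∀ w' ∈ T, G.Adj w' v → w' = w))
  have hcov : S ⊆ (T.powersetCard 2).biUnion A ∪ T.biUnion B := by
    intro v hv
    rw [Finset.mem_union, Finset.mem_biUnion, Finset.mem_biUnion]
    by_cases hvT : v ∈ T
    · exact Or.inr ⟨v, hvT, by simp [B, hv]⟩
    · have hex : ∃ w ∈ T, G.Adj w v := by
        by_contra hcon
        push Not at hcon
        have := hmax (insert v T) ⟨Finset.insert_subset hv hTS, by
          intro x hx y hy
          rw [Finset.mem_insert] at hx hy
          rcases hx with rfl | hx <;> rcases hy with rfl | hy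
          · exact G.irrefl
          · exact fun hh => hcon y hy hh.symm
          · exact hcon x hx
          · exact hT x hx y hy⟩
        rw [Finset.card_insert_of_notMem hvT] at this
        omega
      obtain ⟨w, hw, hwv⟩ := hex
      by_cases hu : ∀ w' ∈ T, G.Adj w' v → w' = w
      · exact Or.inr ⟨w, hw, by simp only [B, Finset.mem_filter]; exact ⟨hv, Or.inr ⟨hwv, hu⟩⟩⟩
      · push Not at hu
        obtain ⟨w', hw', hav, hne⟩ := hu
        refine Or.inl ⟨{w', w}, ?_, ?_⟩
        · rw [Finset.mem_powersetCard]
          exact ⟨by intro x; simp; rintro (rfl | rfl) <;> assumption, Finset.card_pair hne⟩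
        · simp [A, hv, hwv, hav]
  have hA : ∀ e ∈ T.powersetCard 2, (A e).card ≤ c - 1 := by
    intro e he
    rw [Finset.mem_powersetCard] at he
    obtain ⟨x, y, hxy, rfl⟩ := Finset.card_eq_two.mp he.2
    have hx : x ∈ T := he.1 (by simp)
    have hy : y ∈ T := he.1 (by simp)
    refine le_trans (Finset.card_le_card ?_) (common_le h hxy (hT x hx y hy))
    intro v
    simp [A]
  have hB : ∀ w ∈ T, (B w).card ≤ a - 1 := by
    intro w hw
    apply clique_lt hno
    intro x hx y hy hxy
    simp only [B, Finset.mem_filter] at hx hy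
    obtain ⟨hxS, hx⟩ := hx
    obtain ⟨hyS, hy⟩ := hy
    rcases hx with rfl | ⟨hwx, hux⟩ <;> rcases hy with rfl | ⟨hwy, huy⟩
    · exact absurd rfl hxy
    · exact hwy
    · exact hwx.symm
    · by_contra hnadj
      have hxT : x ∉ T := fun hh => hT w hw x hh hwx
      have hyT : y ∉ T := fun hh => hT w hw y hh hwy
      have hc1 : (insert x (insert y (T.erase w))).card = T.card + 1 := by
        rw [Finset.card_insert_of_notMem, Finset.card_insert_of_notMem, Finset.card_erase_of_mem hw]
        · have := Finset.card_pos.mpr ⟨w, hw⟩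
          omega
        · exact fun hh => hyT (Finset.mem_of_mem_erase hh)
        · rw [Finset.mem_insert]
          rintro (hh | hh)
          · exact hxy hh
          · exact hxT (Finset.mem_of_mem_erase hh)
      have hx' : ∀ z ∈ T.erase w, ¬ G.Adj z x := fun z hz hh =>
        (Finset.mem_erase.mp hz).1 (hux z (Finset.mem_of_mem_erase hz) hh)
      have hy' : ∀ z ∈ T.erase w, ¬ G.Adj z y := fun z hz hh =>
        (Finset.mem_erase.mp hz).1 (huy z (Finset.mem_of_mem_erase hz) hh)
      have := hmax (insert x (insert y (T.erase w))) ⟨by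
        refine Finset.insert_subset hxS (Finset.insert_subset hyS ?_)
        exact (Finset.erase_subset _ _).trans hTS, by
        intro p hp q hq
        simp only [Finset.mem_insert] at hp hq
        rcases hp with rfl | rfl | hp <;> rcases hq with rfl | rfl | hq
        · exact G.irrefl
        · exact hnadj
        · exact fun hh => hx' q hq hh.symm
        · exact fun hh => hnadj hh.symm
        · exact G.irrefl
        · exact fun hh => hy' q hq hh.symm
        · exact hx' p hp
        · exact hy' p hp
        · exact hT p (Finset.mem_of_mem_erase hp) q (Finset.mem_of_mem_erase hq)⟩
      omega
  have h1 := Finset.card_le_card hcov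
  have h2 := Finset.card_union_le ((T.powersetCard 2).biUnion A) (T.biUnion B)
  have h3 := Finset.card_biUnion_le_card_mul _ A _ hA
  have h4 := Finset.card_biUnion_le_card_mul _ B _ hB
  rw [Finset.card_powersetCard] at h3
  have hTb : T.card ≤ b - 1 := by omega
  have h5 : T.card.choose 2 * (c - 1) ≤ (c - 1) * (b - 1).choose 2 := by
    rw [mul_comm]
    exact Nat.mul_le_mul_left _ (Nat.choose_le_choose 2 hTb)
  have h6 : T.card * (a - 1) ≤ (a - 1) * (b - 1) := by
    rw [mul_comm]
    exact Nat.mul_le_mul_left _ hTb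
  unfold Rc at hS
  omega

open Classical in
theorem greedy_indep {ι : Type*} (r : ι → ι → Prop) (hsymm : ∀ i j, r i j → r j i) (d : ℕ)
    (n : ℕ) : ∀ S : Finset ι, (∀ i ∈ S, (S.filter (fun j => r i j)).card ≤ d) →
      (d + 1) * n ≤ S.card → ∃ T ⊆ S, T.card = n ∧ ∀ i ∈ T, ∀ j ∈ T, i ≠ j → ¬ r i j := by
  induction n with
  | zero => intro S _ _; exact ⟨∅, by simp, by simp, by simp⟩
  | succ n ih =>
    intro S hd hS
    rw [Nat.mul_succ] at hS
    obtain ⟨i, hi⟩ := Finset.card_pos.mp (by omega : 0 < S.card)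
    let S' := (S.filter (fun j => ¬ r i j)).erase i
    have hS' : S' ⊆ S := (Finset.erase_subset _ _).trans (Finset.filter_subset _ _)
    have hc := Finset.card_filter_add_card_filter_not (s := S) (fun j => r i j)
    have he := Finset.pred_card_le_card_erase (s := S.filter (fun j => ¬ r i j)) (a := i)
    have hdi := hd i hi
    obtain ⟨T, hTS, hTc, hT⟩ := ih S' (by
      intro k hk
      exact le_trans (Finset.card_le_card (Finset.filter_subset_filter _ hS')) (hd k (hS' hk)))
      (by change _ ≤ ((S.filter (fun j => ¬ r i j)).erase i).card; omega)
    have hr : ∀ j ∈ T, ¬ r i j := fun j hj =>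
      (Finset.mem_filter.mp (Finset.mem_of_mem_erase (hTS hj))).2
    have hiT : i ∉ T := fun hh => Finset.notMem_erase i _ (hTS hh)
    refine ⟨insert i T, Finset.insert_subset hi (hTS.trans hS'), ?_, ?_⟩
    · rw [Finset.card_insert_of_notMem hiT, hTc]
    · intro p hp q hq hpq
      rw [Finset.mem_insert] at hp hq
      rcases hp with rfl | hp <;> rcases hq with rfl | hq
      · exact absurd rfl hpq
      · exact hr q hq
      · exact fun hh => hr p hp (hsymm _ _ hh)
      · exact hT p hp q hq hpq

theorem le_Rc (c a b : ℕ) (ha : 2 ≤ a) : b ≤ Rc c a b := by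
  unfold Rc
  have : 1 * (b - 1) ≤ (a - 1) * (b - 1) := Nat.mul_le_mul_right _ (by omega)
  omega

open Classical in
theorem high_case {V : Type*} [Fintype V] {G : SimpleGraph V} {c a b : ℕ} (ha : 2 ≤ a)
    (h : CClosed G c) (hno : ¬ ∃ s : Finset V, G.IsNClique a s) (S : Finset V)
    (hS : Rc c a (Rc c a b) ≤ S.card)
    (hpos : ∀ v ∈ S, 1 ≤ G.degree v)
    (hdeg : ∀ v ∈ S, c * Rc c a (Rc c a b) ≤ G.degree v) : HasInducedMatching G b := by
  obtain ⟨T, hTS, hTc, hT⟩ := ramsey_closed h hno S hS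
  have hle := le_Rc c a (Rc c a b) ha
  have hpriv : ∀ w ∈ T, ∃ x, G.Adj w x ∧ ∀ w' ∈ T, G.Adj w' x → w' = w := by
    intro w hw
    by_contra hcon
    push Not at hcon
    have hcov : G.neighborFinset w ⊆ (T.erase w).biUnion
        (fun w' => Finset.univ.filter (fun x => G.Adj w x ∧ G.Adj w' x)) := by
      intro x hx
      rw [SimpleGraph.mem_neighborFinset] at hx
      obtain ⟨w', hw', hadj, hne⟩ := hcon x hx
      rw [Finset.mem_biUnion]
      exact ⟨w', Finset.mem_erase.mpr ⟨hne, hw'⟩, by simp [hx, hadj]⟩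
    have h1 := Finset.card_le_card hcov
    have h2 := Finset.card_biUnion_le_card_mul (T.erase w)
      (fun w' => Finset.univ.filter (fun x => G.Adj w x ∧ G.Adj w' x)) (c - 1) (by
        intro w' hw'
        exact common_le h (Finset.ne_of_mem_erase hw').symm
          (hT w hw w' (Finset.mem_of_mem_erase hw')))
    rw [Finset.card_erase_of_mem hw, hTc] at h2
    rw [SimpleGraph.card_neighborFinset_eq_degree] at h1
    have h3 := hpos w (hTS hw)
    have h4 := hdeg w (hTS hw)
    rcases Nat.eq_zero_or_pos c with rfl | hc
    · simp only [Nat.zero_sub, Nat.mul_zero] at h2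
      omega
    · have h5 : (Rc c a b - 1) * (c - 1) ≤ (Rc c a b - 1) * c := Nat.mul_le_mul_left _ (by omega)
      have h6 : (Rc c a b - 1) * c < c * Rc c a (Rc c a b) := by
        rw [mul_comm]
        have : 1 ≤ Rc c a b := by unfold Rc; omega
        exact Nat.mul_lt_mul_of_pos_left (by omega) hc
      omega
  choose! x hx1 hx2 using hpriv
  have hinj : Set.InjOn x T := by
    intro p hp q hq hpq
    exact hx2 q hq p hp (hpq ▸ hx1 p hp)
  obtain ⟨Y, hYS, hYc, hY⟩ := ramsey_closed (b := b) h hno (T.image x)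
    (by rw [Finset.card_image_of_injOn hinj, hTc])
  let e := Y.equivFinOfCardEq hYc
  have hz : ∀ y ∈ Y, ∃ z ∈ T, x z = y := fun y hy => by
    simpa using hYS hy
  choose! z hzT hxz using hz
  have hzadj : ∀ p ∈ Y, G.Adj (z p) p := fun p hp => by
    have := hx1 (z p) (hzT p hp)
    rwa [hxz p hp] at this
  have hzu : ∀ p ∈ Y, ∀ w ∈ T, G.Adj w p → w = z p := fun p hp w hw hh =>
    hx2 (z p) (hzT p hp) w hw (by rwa [hxz p hp])
  refine ⟨fun i => z (e.symm i), fun i => (e.symm i : V), fun i => hzadj _ (e.symm i).2, ?_⟩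
  intro i j hij
  have hi := (e.symm i).2
  have hj := (e.symm j).2
  have hne : (e.symm i : V) ≠ e.symm j := fun hh => hij (e.symm.injective (Subtype.ext hh))
  have hzne : z (e.symm i) ≠ z (e.symm j) := fun hh => hne (by
    rw [← hxz _ hi, ← hxz _ hj, hh])
  refine ⟨⟨hzne, hne, ?_⟩, hT _ (hzT _ hi) _ (hzT _ hj), hY _ hi _ hj, ?_⟩
  · intro hh
    have hh' : z (e.symm i) = (e.symm j : V) := hh
    have h1 : G.Adj (z (e.symm j)) (z (e.symm i)) := by
      have h2 := hzadj _ hj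
      generalize z (e.symm j) = q at h2 ⊢
      rwa [hh']
    exact hT _ (hzT _ hj) _ (hzT _ hi) h1
  · exact fun hh => hzne (hzu _ hj _ (hzT _ hi) hh)

open Classical in
theorem low_case {V : Type*} [Fintype V] {G : SimpleGraph V} {N D n b : ℕ} (f g : Fin N → V)
    (hfg : ∀ i, G.Adj (f i) (g i))
    (hd : ∀ i j, i ≠ j → f i ≠ f j ∧ g i ≠ g j ∧ f i ≠ g j) (S : Finset (Fin N))
    (hS : (2 * D + 1) * n ≤ S.card)
    (hlow : ∀ i ∈ S, G.degree (f i) < D ∧ G.degree (g i) < D) (hb : b ≤ n) :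
    HasInducedMatching G b := by
  obtain ⟨r, hrdef⟩ : ∃ r : Fin N → Fin N → Prop, ∀ i j, r i j ↔
    (G.Adj (f i) (f j) ∨ G.Adj (f i) (g j) ∨ G.Adj (g i) (f j) ∨ G.Adj (g i) (g j)) :=
    ⟨_, fun _ _ => Iff.rfl⟩
  have hinj : ∀ i j u, (f i = u ∨ g i = u) → (f j = u ∨ g j = u) → i = j := by
    intro i j u hi hj
    by_contra hij
    have h1 := hd i j hij
    have h2 := hd j i (Ne.symm hij)
    grind
  obtain ⟨T, -, hTc, hT⟩ := greedy_indep r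
    (by
      intro i j hr
      rw [hrdef] at hr
      simp only [hrdef, G.adj_comm (f j), G.adj_comm (g j)]
      tauto) (2 * D) n S (by
    intro i hi
    obtain ⟨h1, h2⟩ := hlow i hi
    let U := G.neighborFinset (f i) ∪ G.neighborFinset (g i)
    have hU : U.card ≤ 2 * D := by
      have := Finset.card_union_le (G.neighborFinset (f i)) (G.neighborFinset (g i))
      rw [SimpleGraph.card_neighborFinset_eq_degree, SimpleGraph.card_neighborFinset_eq_degree]
        at this
      change (G.neighborFinset (f i) ∪ G.neighborFinset (g i)).card ≤ _
      omega
    refine le_trans ?_ hU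
    apply Finset.card_le_card_of_injOn (fun j => if f j ∈ U then f j else g j)
    · intro j hj
      have hj' := (Finset.mem_filter.mp hj).2
      simp only [hrdef] at hj'
      have : f j ∈ U ∨ g j ∈ U := by simp [U]; tauto
      dsimp only
      split_ifs with hf
      · exact hf
      · exact this.resolve_left hf
    · intro p _ q _ hpq
      refine hinj p q (if f p ∈ U then f p else g p) ?_ ?_
      · split_ifs <;> simp
      · dsimp only at hpq
        rw [hpq]
        split_ifs <;> simp) hS
  obtain ⟨T', hT'T, hT'c⟩ := Finset.exists_subset_card_eq (hTc ▸ hb)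
  let e := T'.equivFinOfCardEq hT'c
  refine ⟨fun i => f (e.symm i), fun i => g (e.symm i), fun i => hfg _, ?_⟩
  intro i j hij
  have hne : (e.symm i : Fin N) ≠ e.symm j := fun hh => hij (e.symm.injective (Subtype.ext hh))
  have := hT _ (hT'T (e.symm i).2) _ (hT'T (e.symm j).2) hne
  simp only [hrdef, not_or] at this
  exact ⟨hd _ _ hne, this.1, this.2.2.2, this.2.1⟩

theorem stmt14 {V : Type*} [Fintype V] (G : SimpleGraph V) (c a b : ℕ)
    (h : CClosed G c)
    (hM : HasMatching G (Qc c (Rc c a (Rc c a b)))) :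
    (∃ s : Finset V, G.IsNClique a s) ∨ HasInducedMatching G b := by
  classical
  by_cases hno : ∃ s : Finset V, G.IsNClique a s
  · exact Or.inl hno
  right
  obtain ⟨n, hn⟩ : ∃ n, n = Rc c a (Rc c a b) := ⟨_, rfl⟩
  rw [← hn] at hM
  obtain ⟨f, g, hfg, hd⟩ := hM
  have hQ : 0 < Qc c n := by
    have : 0 < n := by rw [hn]; unfold Rc; omega
    unfold Qc; omega
  have ha : 2 ≤ a := by
    by_contra hlt
    have := clique_lt hno ∅ (by simp)
    rcases (by omega : a = 0 ∨ a = 1) with rfl | rfl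
    · exact hno ⟨∅, by simp⟩
    · exact hno ⟨{f ⟨0, hQ⟩}, by simp [SimpleGraph.isNClique_iff]⟩
  have hbn : b ≤ n := hn ▸ (le_Rc c a b ha).trans (le_Rc c a _ ha)
  let H := Finset.univ.filter (fun i => c * n ≤ G.degree (f i) ∨ c * n ≤ G.degree (g i))
  have hsplit := Finset.card_filter_add_card_filter_not (s := Finset.univ)
    (fun i => c * n ≤ G.degree (f i) ∨ c * n ≤ G.degree (g i))
  rw [Finset.card_univ, Fintype.card_fin] at hsplit
  by_cases hH : n ≤ H.card
  · let p := fun i => if c * n ≤ G.degree (f i) then f i else g i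
    have hp : Function.Injective p := by
      intro i j hij
      by_contra hne
      have h1 := hd i j hne
      have h2 := hd j i (Ne.symm hne)
      simp only [p] at hij
      grind
    refine high_case ha h hno (H.image p) ?_ ?_ ?_
    · rw [← hn, Finset.card_image_of_injective _ hp]
      exact hH
    · intro v hv
      obtain ⟨i, -, rfl⟩ := Finset.mem_image.mp hv
      have : 0 < G.degree (p i) := by
        rw [SimpleGraph.degree_pos_iff_exists_adj]
        simp only [p]
        split_ifs
        · exact ⟨_, hfg i⟩
        · exact ⟨_, (hfg i).symm⟩
      exact this
    · rw [← hn]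
      intro v hv
      obtain ⟨i, hi, rfl⟩ := Finset.mem_image.mp hv
      have hi' := (Finset.mem_filter.mp hi).2
      by_cases hf : c * n ≤ G.degree (f i)
      · have hpi : p i = f i := if_pos hf
        rw [hpi]
        exact hf
      · have hpi : p i = g i := if_neg hf
        rw [hpi]
        exact hi'.resolve_left hf
  · refine low_case (D := c * n) (n := n) f g hfg hd
      (Finset.univ.filter (fun i => ¬ (c * n ≤ G.degree (f i) ∨ c * n ≤ G.degree (g i)))) ?_ ?_ hbn
    · have h1 : (2 * (c * n) + 1) * n = 2 * c * n ^ 2 + n := by ring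
      rw [h1]
      change _ = 2 * c * n ^ 2 + 2 * n at hsplit
      simp only [H] at hH
      omega
    · intro i hi
      have := (Finset.mem_filter.mp hi).2
      omega
end

section
/- Define R_c(a, b) := (c−1)·binom(b−1, 2) + (a−1)(b−1) + 1. Let c, k ≥ 1, let α' be an integer with α' ≥ 6·c^{3/2}·k + 2ck + 1, and let α := R_c(α', k). Let G be a c-closed graph that contains no two distinct simplicial vertices u, v with N[u] = N[v]. If G has at least R_c(c·α + 1, k) vertices, then G contains an irredundant set of size at least k. -/
/-- A set `S` is irredundant in `G` if every `v ∈ S` has a private neighbor: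
some `w ∈ N[v]` (possibly `w = v`) with `w ∉ N(u)` for every `u ∈ S \ {v}`. -/
def Irredundant {V : Type*} (G : SimpleGraph V) (S : Set V) : Prop :=
  ∀ v ∈ S, ∃ w ∈ insert v (G.neighborSet v), ∀ u ∈ S \ {v}, w ∉ G.neighborSet u

open Classical in
/-- Either a large independent set or a large clique exists in a `c`-closed graph. -/
theorem cclosed_ramsey {V : Type*} [Fintype V] (G : SimpleGraph V) (c a b : ℕ)
    (h : CClosed G c) (ha : 1 ≤ a) (hcard : Rc c a b ≤ Fintype.card V) :
    (∃ I : Finset V, b ≤ I.card ∧ ∀ u ∈ I, ∀ v ∈ I, ¬ G.Adj u v) ∨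
    (∃ C : Finset V, a ≤ C.card ∧ G.IsClique (C : Set V)) := by
  obtain ⟨I, hI, hmax⟩ := Finset.exists_max_image
    ((Finset.univ : Finset (Finset V)).filter (fun I => ∀ u ∈ I, ∀ v ∈ I, ¬ G.Adj u v))
    Finset.card ⟨∅, by simp⟩
  simp only [Finset.mem_filter, Finset.mem_univ, true_and] at hI hmax
  by_cases hb : b ≤ I.card
  · exact Or.inl ⟨I, hb, hI⟩
  right
  by_contra hno
  push Not at hno hb
  let P : V → Finset V := fun i => Finset.univ.filter
    (fun v => v = i ∨ (∀ j ∈ I, G.Adj j v ↔ j = i))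
  let Q : Finset V → Finset V := fun s => Finset.univ.filter (fun v => ∀ i ∈ s, G.Adj i v)
  have hP : ∀ i ∈ I, (P i).card ≤ a - 1 := by
    intro i hi
    have hcl : G.IsClique (P i : Set V) := by
      intro u hu v hv huv
      simp only [P, Finset.coe_filter, Finset.mem_univ, true_and, Set.mem_ofPred_eq] at hu hv
      rcases hu with rfl | hu
      · rcases hv with rfl | hv
        · exact absurd rfl huv
        · exact (hv u hi).2 rfl
      · rcases hv with rfl | hv
        · exact ((hu v hi).2 rfl).symm
        · by_contra hadj
          have huI : u ∉ I := fun hh => hI i hi u hh ((hu i hi).2 rfl)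
          have hvI : v ∉ I := fun hh => hI i hi v hh ((hv i hi).2 rfl)
          have := hmax (insert u (insert v (I.erase i))) (by
            have hadj' : ¬ G.Adj v u := fun hh => hadj hh.symm
            have h1 : ∀ j ∈ I, j ≠ i → ¬ G.Adj j u := fun j hj hne hh => hne ((hu j hj).1 hh)
            have h2 : ∀ j ∈ I, j ≠ i → ¬ G.Adj j v := fun j hj hne hh => hne ((hv j hj).1 hh)
            intro x hx y hy
            simp only [Finset.mem_insert, Finset.mem_erase] at hx hy
            rcases hx with rfl | rfl | ⟨hx, hx'⟩ <;> rcases hy with rfl | rfl | ⟨hy, hy'⟩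
            · exact G.irrefl
            · exact hadj
            · exact fun hh => h1 y hy' hy hh.symm
            · exact hadj'
            · exact G.irrefl
            · exact fun hh => h2 y hy' hy hh.symm
            · exact h1 x hx' hx
            · exact h2 x hx' hx
            · exact hI x hx' y hy')
          rw [Finset.card_insert_of_notMem (by simp [huv, huI]),
            Finset.card_insert_of_notMem (by simp [hvI]), Finset.card_erase_of_mem hi] at this
          have : 0 < I.card := Finset.card_pos.2 ⟨i, hi⟩
          omega
    by_contra hlt
    exact hno (P i) (by omega) hcl
  have hQ : ∀ s ∈ Finset.powersetCard 2 I, (Q s).card ≤ c - 1 := by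
    intro s hs
    rw [Finset.mem_powersetCard] at hs
    obtain ⟨x, y, hxy, rfl⟩ := Finset.card_eq_two.1 hs.2
    have hx : x ∈ I := hs.1 (by simp)
    have hy : y ∈ I := hs.1 (by simp)
    have := h x y hxy (hI x hx y hy)
    have he : (G.neighborSet x ∩ G.neighborSet y) = (Q {x, y} : Set V) := by
      ext v; simp [Q]
    rw [he, Set.ncard_coe_finset] at this
    omega
  have hcov : (Finset.univ : Finset V) ⊆
      (Finset.powersetCard 2 I).biUnion Q ∪ I.biUnion P := by
    intro v _
    simp only [Finset.mem_union, Finset.mem_biUnion]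
    by_cases hv : v ∈ I
    · exact Or.inr ⟨v, hv, by simp [P]⟩
    have hex : ∃ i ∈ I, G.Adj i v := by
      by_contra hne
      push Not at hne
      have := hmax (insert v I) (by
        intro x hx y hy
        simp only [Finset.mem_insert] at hx hy
        rcases hx with rfl | hx <;> rcases hy with rfl | hy
        · exact G.irrefl
        · exact fun hh => hne y hy hh.symm
        · exact hne x hx
        · exact hI x hx y hy)
      rw [Finset.card_insert_of_notMem hv] at this
      omega
    obtain ⟨i, hi, hiv⟩ := hex
    by_cases h2 : ∃ j ∈ I, j ≠ i ∧ G.Adj j v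
    · obtain ⟨j, hj, hne, hjv⟩ := h2
      left
      refine ⟨{i, j}, ?_, by simp [Q, hiv, hjv]⟩
      rw [Finset.mem_powersetCard]
      refine ⟨by intro x hx; simp at hx; rcases hx with rfl | rfl <;> assumption, ?_⟩
      exact Finset.card_pair hne.symm
    · push Not at h2
      right
      refine ⟨i, hi, ?_⟩
      simp only [P, Finset.mem_filter, Finset.mem_univ, true_and]
      right
      intro j hj
      constructor
      · intro hh
        by_contra hne
        exact h2 j hj hne hh
      · rintro rfl
        exact hiv
  have h1 := Finset.card_le_card hcov
  have h2 := Finset.card_union_le ((Finset.powersetCard 2 I).biUnion Q) (I.biUnion P)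
  have h3 := Finset.card_biUnion_le_card_mul _ _ _ hQ
  have h4 := Finset.card_biUnion_le_card_mul _ _ _ hP
  rw [Finset.card_powersetCard] at h3
  rw [Finset.card_univ] at h1
  have h5 : I.card.choose 2 * (c - 1) ≤ (c - 1) * (b - 1).choose 2 := by
    rw [mul_comm]
    exact Nat.mul_le_mul_left _ (Nat.choose_le_choose 2 (by omega))
  have h6 : I.card * (a - 1) ≤ (a - 1) * (b - 1) := by
    rw [mul_comm]
    exact Nat.mul_le_mul_left _ (by omega)
  unfold Rc at hcard
  omega

open Classical in
/-- A large maximum clique yields a large irredundant set. -/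
theorem clique_irredundant {V : Type*} [Fintype V] (G : SimpleGraph V) (c n : ℕ)
    (hc : 1 ≤ c) (h : CClosed G c)
    (hsimp : ∀ u v : V, u ≠ v → G.IsClique (G.neighborSet u) →
      G.IsClique (G.neighborSet v) →
      insert u (G.neighborSet u) ≠ insert v (G.neighborSet v))
    (hC0 : ∃ C : Finset V, c * n + 1 ≤ C.card ∧ G.IsClique (C : Set V)) :
    ∃ S : Finset V, n ≤ S.card ∧ Irredundant G (S : Set V) := by
  obtain ⟨C0, hC0card, hC0⟩ := hC0
  obtain ⟨C, hC, hmax⟩ := Finset.exists_max_image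
    ((Finset.univ : Finset (Finset V)).filter (fun C : Finset V => G.IsClique (C : Set V)))
    Finset.card ⟨∅, by simp⟩
  simp only [Finset.mem_filter, Finset.mem_univ, true_and] at hC hmax
  have hCcard : c * n + 1 ≤ C.card := hC0card.trans (hmax C0 hC0)
  -- outside vertices see few vertices of the clique
  have hout : ∀ w ∉ C, (C.filter (fun v => G.Adj w v)).card ≤ c - 1 := by
    intro w hw
    have hex : ∃ x ∈ C, ¬ G.Adj w x := by
      by_contra hne
      push Not at hne
      have := hmax (insert w C) (by
        rw [Finset.coe_insert, SimpleGraph.isClique_insert]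
        exact ⟨hC, fun b hb _ => hne b hb⟩)
      rw [Finset.card_insert_of_notMem hw] at this
      omega
    obtain ⟨x, hx, hwx⟩ := hex
    have hlt := h w x (by rintro rfl; exact hw hx) hwx
    have hsub : ((C.filter (fun v => G.Adj w v) : Finset V) : Set V) ⊆
        G.neighborSet w ∩ G.neighborSet x := by
      intro v hv
      simp only [Finset.coe_filter, Set.mem_ofPred_eq] at hv
      refine ⟨hv.2, hC hx hv.1 ?_⟩
      rintro rfl
      exact hwx hv.2
    have := Set.ncard_le_ncard hsub (Set.toFinite _)
    rw [Set.ncard_coe_finset] at this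
    omega
  let C' : Finset V := C.filter (fun v => ∃ w, w ∉ C ∧ G.Adj w v)
  have hC' : c * n ≤ C'.card := by
    have hone : (C.filter (fun v => ¬ ∃ w, w ∉ C ∧ G.Adj w v)).card ≤ 1 := by
      rw [Finset.card_le_one]
      have key : ∀ u ∈ C.filter (fun v => ¬ ∃ w, w ∉ C ∧ G.Adj w v),
          G.IsClique (G.neighborSet u) ∧ insert u (G.neighborSet u) = (C : Set V) := by
        intro u hu
        simp only [Finset.mem_filter, not_exists, not_and] at hu
        have hsub : G.neighborSet u ⊆ (C : Set V) := by
          intro w hw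
          by_contra hwC
          exact hu.2 w hwC (SimpleGraph.Adj.symm hw)
        refine ⟨hC.subset hsub, ?_⟩
        ext w
        constructor
        · rintro (rfl | hw)
          · exact hu.1
          · exact hsub hw
        · intro hw
          by_cases hwu : w = u
          · exact Or.inl hwu
          · exact Or.inr (hC hu.1 hw (Ne.symm hwu))
      intro u hu v hv
      by_contra huv
      exact hsimp u v huv (key u hu).1 (key v hv).1 ((key u hu).2.trans (key v hv).2.symm)
    have := Finset.card_filter_add_card_filter_not (s := C) (fun v => ∃ w, w ∉ C ∧ G.Adj w v)
    change C'.card + _ = _ at this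
    omega
  obtain ⟨W, hW, hmin⟩ := Finset.exists_min_image
    ((Finset.univ : Finset (Finset V)).filter
      (fun W => (∀ w ∈ W, w ∉ C) ∧ ∀ v ∈ C', ∃ w ∈ W, G.Adj w v))
    Finset.card ⟨Finset.univ.filter (fun w => w ∉ C), by
      simp only [Finset.mem_filter, Finset.mem_univ, true_and, C']
      exact ⟨fun w hw => hw, fun v hv => hv.2⟩⟩
  simp only [Finset.mem_filter, Finset.mem_univ, true_and] at hW hmin
  obtain ⟨hWC, hWdom⟩ := hW
  have hpriv : ∀ w ∈ W, ∃ v, G.Adj w v ∧ ∀ w' ∈ W, G.Adj w' v → w' = w := by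
    intro w hw
    by_contra hne
    push Not at hne
    have := hmin (W.erase w) ⟨fun x hx => hWC x (Finset.mem_of_mem_erase hx), by
      intro v hv
      obtain ⟨x, hx, hxv⟩ := hWdom v hv
      by_cases hxw : x = w
      · subst hxw
        obtain ⟨y, hy, hyv, hyx⟩ := hne v hxv
        exact ⟨y, Finset.mem_erase.2 ⟨hyx, hy⟩, hyv⟩
      · exact ⟨x, Finset.mem_erase.2 ⟨hxw, hx⟩, hxv⟩⟩
    rw [Finset.card_erase_of_mem hw] at this
    have : 0 < W.card := Finset.card_pos.2 ⟨w, hw⟩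
    omega
  have hWcard : n ≤ W.card := by
    have hsub : C' ⊆ W.biUnion (fun w => C.filter (fun v => G.Adj w v)) := by
      intro v hv
      obtain ⟨w, hw, hwv⟩ := hWdom v hv
      exact Finset.mem_biUnion.2 ⟨w, hw, Finset.mem_filter.2 ⟨(Finset.mem_filter.1 hv).1, hwv⟩⟩
    have h1 := Finset.card_le_card hsub
    have h2 := Finset.card_biUnion_le_card_mul W _ _ (fun w hw => hout w (hWC w hw))
    have h3 : W.card * (c - 1) ≤ c * W.card := by
      rw [mul_comm]; exact Nat.mul_le_mul_right _ (by omega)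
    exact Nat.le_of_mul_le_mul_left (by omega : c * n ≤ c * W.card) (by omega)
  choose! f hf1 hf2 using hpriv
  refine ⟨W.image f, ?_, ?_⟩
  · rw [Finset.card_image_of_injOn]
    · exact hWcard
    · intro x hx y hy hxy
      refine hf2 y hy x hx ?_
      rw [← hxy]; exact hf1 x hx
  · intro v hv
    simp only [Finset.coe_image, Set.mem_image, Finset.mem_coe] at hv
    obtain ⟨w, hw, rfl⟩ := hv
    refine ⟨w, Or.inr (hf1 w hw).symm, ?_⟩
    rintro u ⟨hu, hne⟩ hadj
    simp only [Finset.coe_image, Set.mem_image, Finset.mem_coe] at hu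
    obtain ⟨w', hw', rfl⟩ := hu
    have := hf2 w' hw' w hw (SimpleGraph.Adj.symm hadj)
    subst this
    exact hne rfl

theorem stmt19 {V : Type*} [Fintype V] (G : SimpleGraph V) (c k : ℕ)
    (hc : 1 ≤ c) (hk : 1 ≤ k) (h : CClosed G c)
    (α' : ℕ)
    (hα' : 6 * (c : ℝ) ^ ((3 : ℝ) / 2) * (k : ℝ) + 2 * (c : ℝ) * (k : ℝ) + 1 ≤ (α' : ℝ))
    (hsimp : ∀ u v : V, u ≠ v → G.IsClique (G.neighborSet u) →
      G.IsClique (G.neighborSet v) →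
      insert u (G.neighborSet u) ≠ insert v (G.neighborSet v))
    (hcard : Rc c (c * Rc c α' k + 1) k ≤ Fintype.card V) :
    ∃ S : Finset V, k ≤ S.card ∧ Irredundant G (↑S : Set V) := by
  have hα3 : 2 ≤ α' := by
    have h0 : (0 : ℝ) ≤ 6 * (c : ℝ) ^ ((3 : ℝ) / 2) * (k : ℝ) := by positivity
    have h1 : (1 : ℝ) ≤ (c : ℝ) * k := by exact_mod_cast Nat.mul_pos hc hk
    have : (2 : ℝ) ≤ (α' : ℝ) := by linarith
    exact_mod_cast this
  have hαk : k ≤ Rc c α' k := by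
    unfold Rc
    have : 1 * (k - 1) ≤ (α' - 1) * (k - 1) := Nat.mul_le_mul_right _ (by omega)
    omega
  rcases cclosed_ramsey G c _ k h (by omega) hcard with ⟨I, hIk, hI⟩ | hC
  · refine ⟨I, hIk, fun v hv => ⟨v, Or.inl rfl, fun u hu hadj => ?_⟩⟩
    exact hI u hu.1 v hv hadj
  · obtain ⟨S, hS, hirr⟩ := clique_irredundant G c _ hc h hsimp hC
    exact ⟨S, hαk.trans hS, hirr⟩
end
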